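/- arXiv:1611.02101 — 2 statements merged into one kernel-verified Lean document; each statement's English description precedes it below -/
import Mathlib

section
/- Let L : ℝ^p → ℝ be twice continuously differentiable with vᵀ∇²L(x)v ≤ Λ_max ‖v‖² for all x, v ∈ ℝ^p and some Λ_max > 0, let R : ℝ^p → ℝ be arbitrary, and set f = L + R. Let H ∈ ℝ^{p×p} be symmetric with λ_min ‖v‖² ≤ vᵀHv for all v and some λ_min > 0. Fix σ ∈ (0,1), β ∈ ℝ^p, and μ ≥ Λ_max / ((1 − σ) λ_min). Suppose Δβ* minimizes Δ ↦ ∇L(β)ᵀΔ + ½ μ ΔᵀHΔ + R(β + Δ) over Δ ∈ ℝ^p. Then the Armijo condition with unit step size holds: f(β + Δβ*) ≤ f(β) + σ D, where D = ∇L(β)ᵀΔβ* + R(β + Δβ*) − R(β). -/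
open Matrix Finset

/-- Second-order Taylor upper bound on `[0, 1]` for a real function whose second derivative is
bounded above. -/
theorem le_taylor_of_second_deriv_le {φ φ' φ'' : ℝ → ℝ} {C : ℝ}
    (h₁ : ∀ t, HasDerivAt φ (φ' t) t) (h₂ : ∀ t, HasDerivAt φ' (φ'' t) t)
    (hC : ∀ t, φ'' t ≤ C) : φ 1 ≤ φ 0 + φ' 0 + C / 2 := by
  have hφ' : ∀ t, 0 ≤ t → φ' t ≤ φ' 0 + C * t := by
    intro t ht
    have hd : ∀ s, HasDerivAt (fun s => φ' s - C * s) (φ'' s - C) s := fun s =>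
      ((h₂ s).fun_sub ((hasDerivAt_id' s).const_mul C)).congr_deriv (by ring)
    have := antitone_of_hasDerivAt_nonpos hd (fun s => sub_nonpos.2 (hC s)) ht
    simp only [mul_zero, sub_zero] at this
    linarith
  have hd : ∀ s, HasDerivAt (fun s => φ s - φ' 0 * s - C / 2 * s ^ 2)
      (φ' s - φ' 0 - C * s) s := fun s =>
    (((h₁ s).fun_sub ((hasDerivAt_id' s).const_mul (φ' 0))).fun_sub
      ((hasDerivAt_pow 2 s).const_mul (C / 2))).congr_deriv (by norm_num; ring)
  have hanti := antitoneOn_of_hasDerivWithinAt_nonpos (convex_Icc (0 : ℝ) 1)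
    (fun s _ => (hd s).continuousAt.continuousWithinAt)
    (fun s _ => (hd s).hasDerivWithinAt)
    (fun s hs => by
      rw [interior_Icc] at hs
      linarith [hφ' s hs.1.le])
  have := hanti (Set.left_mem_Icc.2 zero_le_one) (Set.right_mem_Icc.2 zero_le_one) zero_le_one
  norm_num at this
  linarith

/-- Descent lemma along a direction `v`: an upper bound on the second directional derivative in
direction `v` bounds the first-order Taylor remainder. -/
theorem ContDiff.le_add_fderiv_add_of_second_fderiv_le {E : Type*} [NormedAddCommGroup E]
    [NormedSpace ℝ E] {L : E → ℝ} (hL : ContDiff ℝ 2 L) (x v : E) {C : ℝ}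
    (hC : ∀ y, fderiv ℝ (fun z => fderiv ℝ L z v) y v ≤ C) :
    L (x + v) ≤ L x + fderiv ℝ L x v + C / 2 := by
  have hline : ∀ t : ℝ, HasDerivAt (fun t : ℝ => x + t • v) v t := fun t => by
    simpa using ((hasDerivAt_id t).smul_const v).const_add x
  have hL' : Differentiable ℝ (fun z => fderiv ℝ L z v) :=
    ((hL.fderiv_right (m := 1) (by norm_num)).clm_apply contDiff_const).differentiable
      one_ne_zero
  have h := le_taylor_of_second_deriv_le
    (fun t => (hL.differentiable two_ne_zero _).hasFDerivAt.comp_hasDerivAt t (hline t))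
    (fun t => (hL' _).hasFDerivAt.comp_hasDerivAt t (hline t)) (fun t => hC _)
  simpa using h

/-- Avoiding line search: when `μ ≥ Λ_max / ((1 − σ) λ_min)`, the Armijo condition
with unit step size holds at the minimizer of the penalized quadratic model. -/
theorem armijo_unit_step
    (p : ℕ) (L R : (Fin p → ℝ) → ℝ) (Λmax lamMin : ℝ)
    (hLam : 0 < Λmax) (hlam : 0 < lamMin)
    (hL : ContDiff ℝ 2 L)
    (hHess : ∀ x v : Fin p → ℝ,
      (fderiv ℝ (fun y => fderiv ℝ L y v) x) v ≤ Λmax * (∑ j, v j ^ 2))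
    (H : Matrix (Fin p) (Fin p) ℝ) (hHsymm : H.IsSymm)
    (hHlow : ∀ v : Fin p → ℝ, lamMin * (∑ j, v j ^ 2) ≤ v ⬝ᵥ H.mulVec v)
    (σ : ℝ) (hσ : σ ∈ Set.Ioo (0 : ℝ) 1)
    (β : Fin p → ℝ) (μ : ℝ) (hμ : Λmax / ((1 - σ) * lamMin) ≤ μ)
    (Δstar : Fin p → ℝ)
    (hmin : ∀ Δ : Fin p → ℝ,
      fderiv ℝ L β Δstar + (1 / 2) * μ * (Δstar ⬝ᵥ H.mulVec Δstar) + R (β + Δstar)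
        ≤ fderiv ℝ L β Δ + (1 / 2) * μ * (Δ ⬝ᵥ H.mulVec Δ) + R (β + Δ)) :
    L (β + Δstar) + R (β + Δstar)
      ≤ L β + R β + σ * (fderiv ℝ L β Δstar + R (β + Δstar) - R β) := by
  obtain ⟨-, hσ1⟩ := hσ
  have hdescent := hL.le_add_fderiv_add_of_second_fderiv_le β Δstar
    (fun y => hHess y Δstar)
  have hzero := hmin 0
  simp only [map_zero, zero_dotProduct, mul_zero, add_zero, zero_add] at hzero
  have hσ' : 0 < 1 - σ := sub_pos.2 hσ1
  have hc : 0 < (1 - σ) * lamMin := mul_pos hσ' hlam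
  have hμ0 : 0 ≤ μ := (div_pos hLam hc).le.trans hμ
  have hΛ : Λmax ≤ μ * ((1 - σ) * lamMin) := (div_le_iff₀ hc).1 hμ
  have hs : 0 ≤ ∑ j, Δstar j ^ 2 := Finset.sum_nonneg fun j _ => sq_nonneg _
  have hquad := mul_le_mul_of_nonneg_left (hHlow Δstar) (mul_nonneg hσ'.le hμ0)
  have hsmall := mul_le_mul_of_nonneg_right hΛ hs
  have hdecrease := mul_le_mul_of_nonneg_left hzero hσ'.le
  linarith
end

section
/- Let φ(t) = (1/√(2π)) exp(−t²/2) be the standard normal density and Φ(x) = ∫_{−∞}^{x} φ(t) dt the standard normal cumulative distribution function. Fix ŷ ≤ −1 and assume the Mills-ratio bounds |ŷ|·φ(ŷ)/(1 + ŷ²) < Φ(ŷ) < φ(ŷ)/|ŷ|. Then ŷ·φ(ŷ)/Φ(ŷ) + φ(ŷ)²/Φ(ŷ)² < 2 + 1/ŷ² ≤ 3. -/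
/-- The standard normal density. -/
noncomputable def stdNormalPDF (t : ℝ) : ℝ :=
  (1 / Real.sqrt (2 * Real.pi)) * Real.exp (-t ^ 2 / 2)

/-- The standard normal cumulative distribution function. -/
noncomputable def stdNormalCDF (x : ℝ) : ℝ :=
  ∫ t in Set.Iic x, stdNormalPDF t

/-- If `r` lies strictly between `s` and `(1 + s²) / s`, then `r² - s r < 2 + 1 / s²`. -/
theorem sq_sub_mul_lt_of_mem_Ioo {s r : ℝ} (hs : 0 < s) (hlow : s < r)
    (hupp : r < (1 + s ^ 2) / s) : r ^ 2 - s * r < 2 + 1 / s ^ 2 := by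
  have hsq : r ^ 2 < ((1 + s ^ 2) / s) ^ 2 :=
    pow_lt_pow_left₀ hupp (hs.trans hlow).le two_ne_zero
  have hexp : ((1 + s ^ 2) / s) ^ 2 = s ^ 2 + 2 + 1 / s ^ 2 := by
    field_simp
    ring
  nlinarith

/-- Bound on the second derivative of the probit loss for `yhat ≤ −1`, assuming the
Mills-ratio bounds `|yhat|·φ(yhat)/(1 + yhat²) < Φ(yhat) < φ(yhat)/|yhat|`:
`yhat·φ(yhat)/Φ(yhat) + φ(yhat)²/Φ(yhat)² < 2 + 1/yhat² ≤ 3`. -/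
theorem probit_second_deriv_bound_neg (yhat : ℝ) (hyhat : yhat ≤ -1)
    (hlow : |yhat| * stdNormalPDF yhat / (1 + yhat ^ 2) < stdNormalCDF yhat)
    (hupp : stdNormalCDF yhat < stdNormalPDF yhat / |yhat|) :
    yhat * stdNormalPDF yhat / stdNormalCDF yhat + stdNormalPDF yhat ^ 2 / stdNormalCDF yhat ^ 2
        < 2 + 1 / yhat ^ 2 ∧
    2 + 1 / yhat ^ 2 ≤ 3 := by
  have hneg : yhat < 0 := by linarith
  have hs : 0 < -yhat := neg_pos.mpr hneg
  rw [abs_of_neg hneg] at hlow hupp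
  have hpdf : 0 < stdNormalPDF yhat := by
    unfold stdNormalPDF
    positivity
  have hcdf : 0 < stdNormalCDF yhat := lt_trans (by positivity) hlow
  constructor
  · have hratio_low : -yhat < stdNormalPDF yhat / stdNormalCDF yhat := by
      rw [lt_div_iff₀ hs] at hupp
      rw [lt_div_iff₀ hcdf]
      linarith
    have hratio_upp :
        stdNormalPDF yhat / stdNormalCDF yhat < (1 + (-yhat) ^ 2) / -yhat := by
      rw [div_lt_iff₀ (by positivity)] at hlow
      rw [div_lt_div_iff₀ hcdf hs]
      linarith
    have h := sq_sub_mul_lt_of_mem_Ioo hs hratio_low hratio_upp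
    rw [neg_sq, div_pow] at h
    rw [mul_div_assoc]
    linarith
  · have hsq : 1 ≤ yhat ^ 2 := by nlinarith
    have hinv : 1 / yhat ^ 2 ≤ 1 := div_le_one_of_le₀ hsq (by positivity)
    linarith
end
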